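/- (Theorem 4.2, L_p Brunn–Minkowski inequality for moments of inertia.) Let n ≥ 1 and p ∈ (1,∞), and let K, L ∈ 𝒦ⁿₒ be origin-symmetric convex bodies (K = -K and L = -L). Then I(K +_p L)^{p/(n+2)} ≥ I(K)^{p/(n+2)} + I(L)^{p/(n+2)}, with equality if and only if K and L are dilates. Here I(K) = ∫_K |x - c_K|² dx is the moment of inertia of K, where c_K = (1/V_n(K)) ∫_K x dx is the centroid of K; for origin-symmetric K this equals ∫_K |x|² dx. -/

import Mathlib

open scoped Pointwise RealInnerProductSpace

/-- A convex body in `ℝⁿ`: a compact convex set with nonempty interior. -/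
def IsConvexBody {n : ℕ} (K : Set (EuclideanSpace ℝ (Fin n))) : Prop :=
  IsCompact K ∧ Convex ℝ K ∧ (interior K).Nonempty

/-- A convex body containing the origin in its interior. -/
def IsConvexBodyO {n : ℕ} (K : Set (EuclideanSpace ℝ (Fin n))) : Prop :=
  IsCompact K ∧ Convex ℝ K ∧ (0 : EuclideanSpace ℝ (Fin n)) ∈ interior K

/-- The support function of a set: `h_K(u) = sup { ⟪x, u⟫ : x ∈ K }`. -/
noncomputable def supp {n : ℕ} (K : Set (EuclideanSpace ℝ (Fin n)))
    (u : EuclideanSpace ℝ (Fin n)) : ℝ :=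
  sSup ((fun x => ⟪x, u⟫) '' K)

open MeasureTheory

/-- The centroid of a set: `c_K = (1/V_n(K)) ∫_K x dx`. -/
noncomputable def centroid {n : ℕ} (K : Set (EuclideanSpace ℝ (Fin n))) :
    EuclideanSpace ℝ (Fin n) :=
  (volume K).toReal⁻¹ • ∫ x in K, x

/-- The moment of inertia of a set: `I(K) = ∫_K |x - c_K|² dx`. -/
noncomputable def inertia {n : ℕ} (K : Set (EuclideanSpace ℝ (Fin n))) : ℝ :=
  ∫ x in K, ‖x - centroid K‖ ^ 2

open scoped ENNReal

theorem bm1_compact {A B : Set ℝ} (hA : IsCompact A) (hB : IsCompact B)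
    (hA' : A.Nonempty) (hB' : B.Nonempty) {C : Set ℝ} (hC : ∀ x ∈ A, ∀ y ∈ B, x + y ∈ C) :
    volume A + volume B ≤ volume C := by
  obtain ⟨a, ha, hamax⟩ := hA.exists_isGreatest hA'
  obtain ⟨b, hb, hbmin⟩ := hB.exists_isLeast hB'
  have h1 : volume A = volume ((fun x => x + b) '' A) := by
    simp
  have h2 : volume B = volume ((fun x => a + x) '' B) := by
    simp
  have h3 : AEDisjoint volume ((fun x => x + b) '' A) ((fun x => a + x) '' B) := by
    refine measure_mono_null (t := {a + b}) ?_ (by simp)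
    rintro _ ⟨⟨x, hx, rfl⟩, ⟨y, hy, hxy⟩⟩
    have h4 := hamax hx
    have h5 := hbmin hy
    simp only [Set.mem_singleton_iff]
    simp only at hxy
    linarith
  have h4 : MeasurableSet ((fun x => a + x) '' B) :=
    (hB.image (by fun_prop)).measurableSet
  rw [h1, h2, ← measure_union₀ h4.nullMeasurableSet h3]
  apply measure_mono
  rintro _ (⟨x, hx, rfl⟩ | ⟨y, hy, rfl⟩)
  · exact hC _ hx _ hb
  · exact hC _ ha _ hy

theorem vol_eq_iSup {A : Set ℝ} (hA : MeasurableSet A) :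
    volume A = ⨆ K : {K : Set ℝ // IsCompact K ∧ K.Nonempty ∧ K ⊆ A}, volume K.1 := by
  apply le_antisymm
  · apply le_of_forall_lt
    intro r hr
    obtain ⟨K, hKA, hK, hrK⟩ := hA.exists_lt_isCompact hr
    refine hrK.trans_le (le_iSup (fun K : {K : Set ℝ // IsCompact K ∧ K.Nonempty ∧ K ⊆ A} =>
      volume K.1) ⟨K, hK, ?_, hKA⟩)
    exact nonempty_of_measure_ne_zero (ne_bot_of_gt hrK)
  · exact iSup_le fun K => measure_mono K.2.2.2

theorem bm1 {A B : Set ℝ} (hA : MeasurableSet A) (hB : MeasurableSet B)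
    (hA' : A.Nonempty) (hB' : B.Nonempty) {C : Set ℝ} (hC : ∀ x ∈ A, ∀ y ∈ B, x + y ∈ C) :
    volume A + volume B ≤ volume C := by
  rw [vol_eq_iSup hA, vol_eq_iSup hB]
  have : Nonempty {K : Set ℝ // IsCompact K ∧ K.Nonempty ∧ K ⊆ A} :=
    hA'.elim fun a ha => ⟨{a}, isCompact_singleton, by simp, by simpa⟩
  have : Nonempty {K : Set ℝ // IsCompact K ∧ K.Nonempty ∧ K ⊆ B} :=
    hB'.elim fun a ha => ⟨{a}, isCompact_singleton, by simp, by simpa⟩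
  apply ENNReal.iSup_add_iSup_le
  intro K K'
  exact bm1_compact K.2.1 K'.2.1 K.2.2.1 K'.2.2.1
    fun x hx y hy => hC x (K.2.2.2 hx) y (K'.2.2.2 hy)

theorem bm1_comb {A B : Set ℝ} (hA : MeasurableSet A) (hB : MeasurableSet B)
    (hA' : A.Nonempty) (hB' : B.Nonempty) {C : Set ℝ} {l k : ℝ} (hl : 0 < l) (hk : 0 < k)
    (hC : ∀ x ∈ A, ∀ y ∈ B, l * x + k * y ∈ C) :
    ENNReal.ofReal l * volume A + ENNReal.ofReal k * volume B ≤ volume C := by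
  have h1 : volume (l • A) = ENNReal.ofReal l * volume A := by
    rw [Measure.addHaar_smul]; simp [abs_of_pos hl]
  have h2 : volume (k • B) = ENNReal.ofReal k * volume B := by
    rw [Measure.addHaar_smul]; simp [abs_of_pos hk]
  rw [← h1, ← h2]
  apply bm1 (hA.const_smul₀ l) (hB.const_smul₀ k) hA'.smul_set hB'.smul_set
  rintro _ ⟨x, hx, rfl⟩ _ ⟨y, hy, rfl⟩
  exact hC x hx y hy

theorem layer {f : ℝ → ℝ≥0∞} (hf : Measurable f) (hf' : ∀ x, f x ≠ ⊤) :
    ∫⁻ x, f x = ∫⁻ t in Set.Ioi (0:ℝ), volume {x | ENNReal.ofReal t < f x} := by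
  have := lintegral_eq_lintegral_meas_lt (volume : Measure ℝ) (f := fun x => (f x).toReal)
    (Filter.Eventually.of_forall fun x => ENNReal.toReal_nonneg) hf.ennreal_toReal.aemeasurable
  simp only [ENNReal.ofReal_toReal (hf' _)] at this
  rw [this]
  refine setLIntegral_congr_fun measurableSet_Ioi ?_
  intro t ht
  simp only
  congr 1
  ext x
  simp only [Set.mem_ofPred_eq]
  exact (ENNReal.ofReal_lt_iff_lt_toReal (le_of_lt ht) (hf' x)).symm

theorem pl1_norm {f g h : ℝ → ℝ≥0∞} (hf : Measurable f) (hg : Measurable g) (hh : Measurable h)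
    (hf1 : ⨆ x, f x = 1) (hg1 : ⨆ x, g x = 1) {l k : ℝ} (hl : 0 < l) (hk : 0 < k) (hlk : l + k = 1)
    (H : ∀ x y, f x ^ l * g y ^ k ≤ h (l * x + k * y)) :
    ENNReal.ofReal l * (∫⁻ x, f x) + ENNReal.ofReal k * ∫⁻ x, g x ≤ ∫⁻ x, h x := by
  have hfle : ∀ x, f x ≤ 1 := fun x => hf1 ▸ le_iSup f x
  have hgle : ∀ x, g x ≤ 1 := fun x => hg1 ▸ le_iSup g x
  have e1 : ∀ x, f x ≠ ⊤ := fun x => ne_top_of_le_ne_top ENNReal.one_ne_top (hfle x)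
  have e2 : ∀ x, g x ≠ ⊤ := fun x => ne_top_of_le_ne_top ENNReal.one_ne_top (hgle x)
  calc _ ≤ ∫⁻ x, min (h x) 1 := ?_
    _ ≤ _ := lintegral_mono fun x => min_le_left _ _
  rw [layer hf e1, layer hg e2, layer (hh.min measurable_const) (fun x => by simp),
    ← lintegral_const_mul' _ _ ENNReal.ofReal_ne_top,
    ← lintegral_const_mul' _ _ ENNReal.ofReal_ne_top, ← lintegral_add_left']
  · apply setLIntegral_mono' measurableSet_Ioi
    intro t ht
    rcases lt_or_ge t 1 with h1 | h1
    · have ht1 : ENNReal.ofReal t < 1 := by simpa using h1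
      apply bm1_comb (hf measurableSet_Ioi) (hg measurableSet_Ioi) _ _ hl hk
      · intro x hx y hy
        simp only [Set.mem_preimage, Set.mem_Ioi] at hx hy
        simp only [Set.mem_ofPred_eq, lt_min_iff]
        refine ⟨lt_of_lt_of_le ?_ (H x y), ht1⟩
        calc ENNReal.ofReal t = ENNReal.ofReal t ^ l * ENNReal.ofReal t ^ k := by
              rw [← ENNReal.rpow_add_of_nonneg _ _ hl.le hk.le, hlk, ENNReal.rpow_one]
          _ < _ := ENNReal.mul_lt_mul (ENNReal.rpow_lt_rpow hx hl) (ENNReal.rpow_lt_rpow hy hk)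
      · rw [← hf1] at ht1
        obtain ⟨x, hx⟩ := lt_iSup_iff.1 ht1
        exact ⟨x, hx⟩
      · rw [← hg1] at ht1
        obtain ⟨x, hx⟩ := lt_iSup_iff.1 ht1
        exact ⟨x, hx⟩
    · have ht1 : 1 ≤ ENNReal.ofReal t := by simpa using h1
      have z1 : {x | ENNReal.ofReal t < f x} = ∅ := by
        ext x; simpa using (hfle x).trans ht1
      have z2 : {x | ENNReal.ofReal t < g x} = ∅ := by
        ext x; simpa using (hgle x).trans ht1
      simp [z1, z2]
  · apply Measurable.aemeasurable
    apply Measurable.const_mul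
    apply Antitone.measurable
    intro s t hst
    apply measure_mono
    intro x hx
    exact lt_of_le_of_lt (ENNReal.ofReal_le_ofReal hst) hx

theorem amgm (a b : ℝ≥0∞) {l k : ℝ} (hl : 0 < l) (hk : 0 < k) (hlk : l + k = 1) :
    a ^ l * b ^ k ≤ ENNReal.ofReal l * a + ENNReal.ofReal k * b := by
  rcases eq_or_ne a ⊤ with rfl | ha
  · rw [ENNReal.mul_top (by simpa using hl)]; simp
  rcases eq_or_ne b ⊤ with rfl | hb
  · rw [ENNReal.mul_top (by simpa using hk)]; simp
  lift a to NNReal using ha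
  lift b to NNReal using hb
  have := NNReal.geom_mean_le_arith_mean2_weighted l.toNNReal k.toNNReal a b
    (by rw [← Real.toNNReal_add hl.le hk.le, hlk]; simp)
  rw [Real.coe_toNNReal _ hl.le, Real.coe_toNNReal _ hk.le] at this
  rw [← ENNReal.coe_rpow_of_nonneg _ hl.le, ← ENNReal.coe_rpow_of_nonneg _ hk.le]
  unfold ENNReal.ofReal
  exact_mod_cast this

theorem pl1_bdd {f g h : ℝ → ℝ≥0∞} (hf : Measurable f) (hg : Measurable g) (hh : Measurable h)
    (hf1 : ⨆ x, f x ≠ ⊤) (hg1 : ⨆ x, g x ≠ ⊤) {l k : ℝ} (hl : 0 < l) (hk : 0 < k)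
    (hlk : l + k = 1) (H : ∀ x y, f x ^ l * g y ^ k ≤ h (l * x + k * y)) :
    (∫⁻ x, f x) ^ l * (∫⁻ x, g x) ^ k ≤ ∫⁻ x, h x := by
  set A := ⨆ x, f x with hA
  set B := ⨆ x, g x with hB
  rcases eq_or_ne A 0 with h0 | hA0
  · have : ∀ x, f x = 0 := fun x => le_antisymm (h0 ▸ le_iSup f x) bot_le
    simp [this, hl]
  rcases eq_or_ne B 0 with h0 | hB0
  · have : ∀ x, g x = 0 := fun x => le_antisymm (h0 ▸ le_iSup g x) bot_le
    simp [this, hk]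
  have hAi : A⁻¹ ≠ ⊤ := by simpa using hA0
  have hBi : B⁻¹ ≠ ⊤ := by simpa using hB0
  have hCi : (A⁻¹) ^ l * (B⁻¹) ^ k ≠ ⊤ :=
    ENNReal.mul_ne_top (ENNReal.rpow_ne_top_of_nonneg hl.le hAi)
      (ENNReal.rpow_ne_top_of_nonneg hk.le hBi)
  have hC0 : (A⁻¹) ^ l * (B⁻¹) ^ k ≠ 0 := by
    apply mul_ne_zero <;> simp [ENNReal.rpow_eq_zero_iff, hf1, hg1, hA0, hB0]
  have key := pl1_norm (f := fun x => A⁻¹ * f x) (g := fun x => B⁻¹ * g x)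
    (h := fun x => ((A⁻¹) ^ l * (B⁻¹) ^ k) * h x) (hf.const_mul _) (hg.const_mul _) (hh.const_mul _)
    (by rw [← ENNReal.mul_iSup, ← hA, ENNReal.inv_mul_cancel hA0 hf1])
    (by rw [← ENNReal.mul_iSup, ← hB, ENNReal.inv_mul_cancel hB0 hg1]) hl hk hlk
    (by
      intro x y
      rw [ENNReal.mul_rpow_of_nonneg _ _ hl.le, ENNReal.mul_rpow_of_nonneg _ _ hk.le]
      calc _ = ((A⁻¹) ^ l * (B⁻¹) ^ k) * (f x ^ l * g y ^ k) := by ring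
        _ ≤ _ := by gcongr; exact H x y)
  have key2 := (amgm _ _ hl hk hlk).trans key
  rw [lintegral_const_mul' _ _ hAi, lintegral_const_mul' _ _ hBi, lintegral_const_mul' _ _ hCi,
    ENNReal.mul_rpow_of_nonneg _ _ hl.le, ENNReal.mul_rpow_of_nonneg _ _ hk.le] at key2
  rw [← ENNReal.mul_le_mul_iff_right hC0 hCi]
  calc _ = _ := by ring
    _ ≤ _ := key2

theorem pl1 {f g h : ℝ → ℝ≥0∞} (hf : Measurable f) (hg : Measurable g) (hh : Measurable h)
    {l k : ℝ} (hl : 0 < l) (hk : 0 < k)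
    (hlk : l + k = 1) (H : ∀ x y, f x ^ l * g y ^ k ≤ h (l * x + k * y)) :
    (∫⁻ x, f x) ^ l * (∫⁻ x, g x) ^ k ≤ ∫⁻ x, h x := by
  have trunc : ∀ f : ℝ → ℝ≥0∞, Measurable f →
      ∫⁻ x, f x = ⨆ N : ℕ, ∫⁻ x, min (f x) N := by
    intro f hf
    rw [← lintegral_iSup (fun N => hf.min measurable_const)]
    · congr 1
      ext x
      have : ⨆ N : ℕ, (N : ℝ≥0∞) = ⊤ := ENNReal.iSup_natCast
      rw [← inf_iSup_eq, this]; simp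
    · intro M N hMN x
      exact min_le_min_left _ (by exact_mod_cast hMN)
  have mono : ∀ f : ℝ → ℝ≥0∞, Monotone fun N : ℕ => ∫⁻ x, min (f x) N := by
    intro f M N hMN
    exact lintegral_mono fun x => min_le_min_left _ (by exact_mod_cast hMN)
  rw [trunc f hf, trunc g hg]
  rw [(ENNReal.monotone_rpow_of_nonneg hl.le).map_iSup_of_continuousAt
    (ENNReal.continuous_rpow_const).continuousAt (by simp [hl]),
    (ENNReal.monotone_rpow_of_nonneg hk.le).map_iSup_of_continuousAt
    (ENNReal.continuous_rpow_const).continuousAt (by simp [hk])]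
  rw [ENNReal.iSup_mul]
  refine iSup_le fun M => ?_
  rw [ENNReal.mul_iSup]
  refine iSup_le fun N => ?_
  have bd : ∀ (f : ℝ → ℝ≥0∞) (N : ℕ), ⨆ x, min (f x) N ≠ ⊤ := fun f N =>
    ne_top_of_le_ne_top (ENNReal.natCast_ne_top N) (iSup_le fun x => min_le_right _ _)
  refine pl1_bdd (hf.min measurable_const) (hg.min measurable_const) hh (bd f M) (bd g N)
    hl hk hlk fun x y => le_trans ?_ (H x y)
  gcongr <;> exact min_le_left _ _

theorem pl_pi (n : ℕ) {l k : ℝ} (hl : 0 < l) (hk : 0 < k) (hlk : l + k = 1) :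
    ∀ {f g h : (Fin n → ℝ) → ℝ≥0∞} (_ : Measurable f) (_ : Measurable g) (_ : Measurable h)
    (_ : ∀ x y, f x ^ l * g y ^ k ≤ h (l • x + k • y)),
    (∫⁻ x, f x) ^ l * (∫⁻ x, g x) ^ k ≤ ∫⁻ x, h x := by
  induction n with
  | zero =>
    intro f g h hf hg hh H
    rw [Measure.volume_pi_eq_dirac 0, lintegral_dirac, lintegral_dirac, lintegral_dirac]
    simpa using H 0 0
  | succ n ih =>
    intro f g h hf hg hh H
    have tr : ∀ f : (Fin (n+1) → ℝ) → ℝ≥0∞, Measurable f →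
        ∫⁻ x, f x = ∫⁻ t : ℝ, ∫⁻ y : Fin n → ℝ,
          f ((MeasurableEquiv.piFinSuccAbove (fun _ => ℝ) 0).symm (t, y)) := by
      intro f hf
      have := ((volume_preserving_piFinSuccAbove (fun _ : Fin (n+1) => ℝ) 0).symm).lintegral_comp hf
      rw [← this, Measure.volume_eq_prod, lintegral_prod]
      exact (hf.comp (MeasurableEquiv.measurable _)).aemeasurable
    have ms : ∀ f : (Fin (n+1) → ℝ) → ℝ≥0∞, Measurable f → Measurable fun p : ℝ × (Fin n → ℝ) =>
          f ((MeasurableEquiv.piFinSuccAbove (fun _ => ℝ) 0).symm p) := fun f hf =>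
      hf.comp (MeasurableEquiv.measurable _)
    rw [tr f hf, tr g hg, tr h hh]
    refine pl1 (ms f hf).lintegral_prod_right' (ms g hg).lintegral_prod_right'
      (ms h hh).lintegral_prod_right' hl hk hlk ?_
    intro s t
    refine ih ((ms f hf).comp measurable_prodMk_left) ((ms g hg).comp measurable_prodMk_left)
      ((ms h hh).comp measurable_prodMk_left) ?_
    intro x y
    refine (H _ _).trans (le_of_eq ?_)
    congr 1
    ext i
    refine Fin.cases ?_ (fun j => ?_) i <;>
    simp [MeasurableEquiv.piFinSuccAbove, Fin.insertNthEquiv]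

theorem pl_euc (n : ℕ) {l k : ℝ} (hl : 0 < l) (hk : 0 < k) (hlk : l + k = 1)
    {f g h : EuclideanSpace ℝ (Fin n) → ℝ≥0∞} (hf : Measurable f) (hg : Measurable g)
    (hh : Measurable h)
    (H : ∀ x y, f x ^ l * g y ^ k ≤ h (l • x + k • y)) :
    (∫⁻ x, f x) ^ l * (∫⁻ x, g x) ^ k ≤ ∫⁻ x, h x := by
  have e := PiLp.volume_preserving_toLp (Fin n)
  rw [← e.lintegral_comp hf, ← e.lintegral_comp hg, ← e.lintegral_comp hh]
  refine pl_pi n hl hk hlk (hf.comp e.measurable) (hg.comp e.measurable) (hh.comp e.measurable) ?_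
  intro x y
  exact H _ _

/-- Prékopa–Leindler applied to the weight `⟪x, u⟫₊ ^ 2`. -/
theorem half_le {n : ℕ} {l k : ℝ} (hl : 0 < l) (hk : 0 < k) (hlk : l + k = 1)
    {K L : Set (EuclideanSpace ℝ (Fin n))} (hK : IsCompact K) (hL : IsCompact L)
    (u : EuclideanSpace ℝ (Fin n)) {t : ℝ}
    (h1 : ∫ x in K, (max ⟪x, u⟫ 0) ^ 2 = t) (h2 : ∫ x in L, (max ⟪x, u⟫ 0) ^ 2 = t) :
    t ≤ ∫ x in l • K + k • L, (max ⟪x, u⟫ 0) ^ 2 := by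
  have hN : IsCompact (l • K + k • L) := (hK.smul l).add (hL.smul k)
  have hcont : Continuous fun x : EuclideanSpace ℝ (Fin n) => (max ⟪x, u⟫ 0) ^ 2 := by fun_prop
  have conv : ∀ A : Set (EuclideanSpace ℝ (Fin n)), IsCompact A →
      ENNReal.ofReal (∫ x in A, (max ⟪x, u⟫ 0) ^ 2) =
      ∫⁻ x, A.indicator (fun x => ENNReal.ofReal ((max ⟪x, u⟫ 0) ^ 2)) x := by
    intro A hA
    rw [lintegral_indicator hA.measurableSet, ofReal_integral_eq_lintegral_ofReal]
    · exact hcont.continuousOn.integrableOn_compact hA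
    · exact Filter.Eventually.of_forall fun x => by positivity
  have meas : ∀ A : Set (EuclideanSpace ℝ (Fin n)), IsCompact A →
      Measurable (A.indicator (fun x => ENNReal.ofReal ((max ⟪x, u⟫ 0) ^ 2))) := by
    intro A hA
    exact hcont.measurable.ennreal_ofReal.indicator hA.measurableSet
  have key := pl_euc n hl hk hlk (meas K hK) (meas L hL) (meas _ hN) (by
    intro x y
    by_cases hx : x ∈ K
    swap
    · rw [Set.indicator_of_notMem hx]; simp [hl]
    by_cases hy : y ∈ L
    swap
    · rw [Set.indicator_of_notMem hy]; simp [hk]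
    have hxy : l • x + k • y ∈ l • K + k • L :=
      Set.add_mem_add (Set.smul_mem_smul_set hx) (Set.smul_mem_smul_set hy)
    rw [Set.indicator_of_mem hx, Set.indicator_of_mem hy, Set.indicator_of_mem hxy]
    rw [inner_add_left, inner_smul_left, inner_smul_left]
    simp only [conj_trivial]
    generalize ⟪x, u⟫ = a
    generalize ⟪y, u⟫ = b
    rcases le_or_gt a 0 with ha | ha
    · rw [max_eq_right ha]; simp [hl]
    rcases le_or_gt b 0 with hb | hb
    · rw [max_eq_right hb]; simp [hk]
    have hab : 0 < l * a + k * b := by positivity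
    rw [max_eq_left ha.le, max_eq_left hb.le, max_eq_left hab.le,
      ENNReal.ofReal_rpow_of_nonneg (by positivity) hl.le,
      ENNReal.ofReal_rpow_of_nonneg (by positivity) hk.le, ← ENNReal.ofReal_mul (by positivity)]
    apply ENNReal.ofReal_le_ofReal
    have := Real.geom_mean_le_arith_mean2_weighted hl.le hk.le ha.le hb.le hlk
    calc (a ^ 2) ^ l * (b ^ 2) ^ k = (a ^ l * b ^ k) ^ 2 := by
          rw [mul_pow, ← Real.rpow_natCast, ← Real.rpow_natCast, ← Real.rpow_natCast,
            ← Real.rpow_natCast, ← Real.rpow_mul ha.le, ← Real.rpow_mul hb.le,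
            ← Real.rpow_mul ha.le, ← Real.rpow_mul hb.le, mul_comm l, mul_comm k]
      _ ≤ _ := by gcongr)
  rw [← conv K hK, ← conv L hL, ← conv _ hN, h1, h2,
    ← ENNReal.rpow_add_of_nonneg _ _ hl.le hk.le, hlk, ENNReal.rpow_one] at key
  rwa [ENNReal.ofReal_le_ofReal_iff (by positivity)] at key

theorem setIntegral_neg_symm {n : ℕ} {F : Type*} [NormedAddCommGroup F] [NormedSpace ℝ F]
    {K : Set (EuclideanSpace ℝ (Fin n))} (hK : K = -K)
    (f : EuclideanSpace ℝ (Fin n) → F) : ∫ x in K, f (-x) = ∫ x in K, f x := by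
  have := (Measure.measurePreserving_neg (volume : Measure (EuclideanSpace ℝ (Fin n)))
    ).setIntegral_preimage_emb (MeasurableEquiv.neg _).measurableEmbedding f K
  rw [← this]
  congr 2
  
theorem sq_eq_two_half {n : ℕ} {K : Set (EuclideanSpace ℝ (Fin n))} (hKc : IsCompact K)
    (hK : K = -K) (u : EuclideanSpace ℝ (Fin n)) :
    ∫ x in K, ⟪x, u⟫ ^ 2 = 2 * ∫ x in K, (max ⟪x, u⟫ 0) ^ 2 := by
  have h1 : ∀ x : EuclideanSpace ℝ (Fin n),
      ⟪x, u⟫ ^ 2 = (max ⟪x, u⟫ 0) ^ 2 + (max ⟪-x, u⟫ 0) ^ 2 := by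
    intro x
    rw [inner_neg_left]
    rcases le_total ⟪x, u⟫ 0 with h | h
    · rw [max_eq_right h, max_eq_left (by linarith)]; ring
    · rw [max_eq_left h, max_eq_right (by linarith)]; ring
  simp_rw [h1]
  rw [integral_add, setIntegral_neg_symm hK (fun x => (max ⟪x, u⟫ 0) ^ 2)]
  · ring
  · exact ContinuousOn.integrableOn_compact hKc (Continuous.continuousOn (by fun_prop))
  · exact ContinuousOn.integrableOn_compact hKc (Continuous.continuousOn (by fun_prop))

theorem comb_symm {n : ℕ} {K L : Set (EuclideanSpace ℝ (Fin n))} (hK : K = -K) (hL : L = -L)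
    (l k : ℝ) : l • K + k • L = -(l • K + k • L) := by
  rw [neg_add, ← Set.smul_set_neg, ← Set.smul_set_neg, ← hK, ← hL]

theorem dir_le {n : ℕ} {l k : ℝ} (hl : 0 < l) (hk : 0 < k) (hlk : l + k = 1)
    {K L : Set (EuclideanSpace ℝ (Fin n))} (hK : IsCompact K) (hL : IsCompact L)
    (hKs : K = -K) (hLs : L = -L)
    (u : EuclideanSpace ℝ (Fin n)) 
    (h : ∫ x in K, ⟪x, u⟫ ^ 2 = ∫ x in L, ⟪x, u⟫ ^ 2) :
    ∫ x in K, ⟪x, u⟫ ^ 2 ≤ ∫ x in l • K + k • L, ⟪x, u⟫ ^ 2 := by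
  have hN : IsCompact (l • K + k • L) := (hK.smul l).add (hL.smul k)
  rw [sq_eq_two_half hK hKs, sq_eq_two_half hL hLs] at h
  rw [sq_eq_two_half hK hKs, sq_eq_two_half hN (comb_symm hKs hLs l k)]
  have := half_le hl hk hlk hK hL u (t := ∫ x in K, (max ⟪x, u⟫ 0) ^ 2)
    rfl (by linarith)
  linarith

theorem sum_signs_sq : ∀ (n : ℕ) (c : ℝ) (a : Fin n → ℝ),
    ∑ e : Fin n → Bool, (c + ∑ i, (if e i then 1 else -1) * a i) ^ 2 =
      2 ^ n * (c ^ 2 + ∑ i, a i ^ 2) := by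
  intro n
  induction n with
  | zero => intro c a; simp
  | succ n ih =>
    intro c a
    rw [← (Fin.consEquiv (fun _ : Fin (n+1) => Bool)).sum_comp, Fintype.sum_prod_type,
      Fintype.sum_bool]
    simp only [Fin.consEquiv, Equiv.coe_fn_mk, Fin.sum_univ_succ, Fin.cons_zero, Fin.cons_succ]
    simp only [← add_assoc]
    rw [ih, ih]
    simp
    ring

theorem frame {n : ℕ} (S : Matrix (Fin n) (Fin n) ℝ) (hS : S.IsHermitian) (htr : S.trace = 0) :
    ∃ u : (Fin n → Bool) → EuclideanSpace ℝ (Fin n),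
      (∀ x, ∑ e, ⟪x, u e⟫ ^ 2 = 2 ^ n * ‖x‖ ^ 2) ∧
      ∀ e, ∑ i, ∑ j, S i j * (u e i * u e j) = 0 := by
  set b := hS.eigenvectorBasis with hb
  refine ⟨fun e => ∑ i, (if e i then (1:ℝ) else -1) • b i, ?_, ?_⟩
  · intro x
    have := sum_signs_sq n 0 (fun i => ⟪x, b i⟫)
    simp only [zero_add] at this
    simp only [inner_sum, inner_smul_right]
    rw [this]
    congr 1
    rw [← b.sum_sq_norm_inner_left x]
    simp
  · intro e
    set u := ∑ i, (if e i then (1:ℝ) else -1) • b i with hu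
    change ∑ i, ∑ j, S i j * (u i * u j) = 0
    have h1 : S.toEuclideanLin u = ∑ i, (if e i then (1:ℝ) else -1) • (hS.eigenvalues i • b i) := by
      rw [hu, map_sum]
      congr 1
      ext1 i
      rw [map_smul]
      congr 1
      have := hS.mulVec_eigenvectorBasis i
      ext j
      simpa [Matrix.toEuclideanLin] using congrFun this j
    have h2 : ⟪u, S.toEuclideanLin u⟫ = ∑ i, hS.eigenvalues i := by
      rw [h1, hu]
      simp only [sum_inner, inner_sum, inner_smul_left, inner_smul_right]
      refine Finset.sum_congr rfl fun i _ => ?_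
      rw [Finset.sum_eq_single i]
      · have : ⟪b i, b i⟫ = 1 := by simp
        rw [this]
        split_ifs <;> simp
      · intro j _ hj
        rw [b.orthonormal.2 hj]; simp
      · simp
    have h3 : ∑ i, hS.eigenvalues i = 0 := by
      have := hS.trace_eq_sum_eigenvalues
      rw [htr] at this
      simpa using this.symm
    rw [h3] at h2
    clear h1 h3
    clear_value u
    rw [← h2, PiLp.inner_apply]
    refine Finset.sum_congr rfl fun i _ => ?_
    simp [Matrix.toEuclideanLin, Matrix.mulVec, dotProduct, Finset.sum_mul]
    refine Finset.sum_congr rfl fun j _ => ?_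
    ring

/-- Brunn–Minkowski for the polar moment, normalized form. -/
theorem moment_le {n : ℕ} {l k : ℝ} (hl : 0 < l) (hk : 0 < k) (hlk : l + k = 1)
    {K L : Set (EuclideanSpace ℝ (Fin n))} (hK : IsCompact K) (hL : IsCompact L)
    (hKs : K = -K) (hLs : L = -L)
    (h : ∫ x in K, ‖x‖ ^ 2 = ∫ x in L, ‖x‖ ^ 2) :
    ∫ x in K, ‖x‖ ^ 2 ≤ ∫ x in l • K + k • L, ‖x‖ ^ 2 := by
  have hN : IsCompact (l • K + k • L) := (hK.smul l).add (hL.smul k)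
  have int : ∀ (A : Set (EuclideanSpace ℝ (Fin n))), IsCompact A →
      ∀ f : EuclideanSpace ℝ (Fin n) → ℝ, Continuous f → Integrable f (volume.restrict A) :=
    fun A hA f hf => hf.continuousOn.integrableOn_compact hA
  let S : Matrix (Fin n) (Fin n) ℝ := fun i j => (∫ x in K, x i * x j) - ∫ x in L, x i * x j
  have hS : S.IsHermitian := by
    ext i j
    change star (S j i) = S i j
    simp only [S, mul_comm, star_trivial]
  have htr : S.trace = 0 := by
    simp only [Matrix.trace, Matrix.diag, S, Finset.sum_sub_distrib]
    rw [← integral_finsetSum _ (fun i _ => int K hK _ (by fun_prop)),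
      ← integral_finsetSum _ (fun i _ => int L hL _ (by fun_prop)), sub_eq_zero]
    simp only [EuclideanSpace.real_norm_sq_eq] at h
    simpa [sq] using h
  obtain ⟨u, hu1, hu2⟩ := frame S hS htr
  have quad : ∀ (A : Set (EuclideanSpace ℝ (Fin n))), IsCompact A → ∀ v : EuclideanSpace ℝ (Fin n),
      ∫ x in A, ⟪x, v⟫ ^ 2 = ∑ i, ∑ j, (∫ x in A, x i * x j) * (v i * v j) := by
    intro A hA v
    have : ∀ x : EuclideanSpace ℝ (Fin n),
        ⟪x, v⟫ ^ 2 = ∑ i, ∑ j, (x i * x j) * (v i * v j) := by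
      intro x
      rw [PiLp.inner_apply, sq, Finset.sum_mul_sum]
      refine Finset.sum_congr rfl fun i _ => Finset.sum_congr rfl fun j _ => ?_
      simp
      ring
    simp_rw [this]
    rw [integral_finsetSum _ (fun i _ => int A hA _ (by fun_prop))]
    refine Finset.sum_congr rfl fun i _ => ?_
    rw [integral_finsetSum _ (fun i _ => int A hA _ (by fun_prop))]
    refine Finset.sum_congr rfl fun j _ => ?_
    rw [integral_mul_const]
  have heq : ∀ e, ∫ x in K, ⟪x, u e⟫ ^ 2 = ∫ x in L, ⟪x, u e⟫ ^ 2 := by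
    intro e
    rw [quad K hK, quad L hL, ← sub_eq_zero, ← hu2 e, ← Finset.sum_sub_distrib]
    refine Finset.sum_congr rfl fun i _ => ?_
    rw [← Finset.sum_sub_distrib]
    refine Finset.sum_congr rfl fun j _ => ?_
    simp only [S]
    ring
  have tot : ∀ (A : Set (EuclideanSpace ℝ (Fin n))), IsCompact A →
      ∑ e, ∫ x in A, ⟪x, u e⟫ ^ 2 = 2 ^ n * ∫ x in A, ‖x‖ ^ 2 := by
    intro A hA
    rw [← integral_finsetSum _ (fun i _ => int A hA _ (by fun_prop)), ← integral_const_mul]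
    simp_rw [hu1]
  have : 2 ^ n * ∫ x in K, ‖x‖ ^ 2 ≤ 2 ^ n * ∫ x in l • K + k • L, ‖x‖ ^ 2 := by
    rw [← tot K hK, ← tot _ hN]
    exact Finset.sum_le_sum fun e _ => dir_le hl hk hlk hK hL hKs hLs (u e) (heq e)
  exact le_of_mul_le_mul_left this (by positivity)

theorem inertia_symm {n : ℕ} {K : Set (EuclideanSpace ℝ (Fin n))} (hK : K = -K) :
    inertia K = ∫ x in K, ‖x‖ ^ 2 := by
  have h1 : ∫ x in K, x = 0 := by
    have := setIntegral_neg_symm hK (fun x => x)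
    rw [integral_neg] at this
    have h : (2 : ℝ) • ∫ x in K, x = 0 := by
      rw [two_smul]
      nth_rewrite 1 [← this]
      simp
    exact (smul_eq_zero.1 h).resolve_left (by norm_num)
  have h2 : centroid K = 0 := by rw [centroid, h1, smul_zero]
  simp [inertia, h2]

theorem moment_smul {n : ℕ} (K : Set (EuclideanSpace ℝ (Fin n))) {c : ℝ} (hc : 0 < c) :
    ∫ x in c • K, ‖x‖ ^ 2 = c ^ (n + 2) * ∫ x in K, ‖x‖ ^ 2 := by
  have := Measure.setIntegral_comp_smul_of_pos (volume : Measure (EuclideanSpace ℝ (Fin n)))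
    (fun x => ‖x‖ ^ 2) K hc
  simp only [norm_smul, mul_pow, finrank_euclideanSpace_fin, smul_eq_mul, Real.norm_eq_abs,
    sq_abs] at this
  rw [integral_const_mul] at this
  have hc' : c ^ n ≠ 0 := by positivity
  field_simp at this
  rw [← this]; ring

theorem moment_strict {n : ℕ} (hn : 1 ≤ n) {N M U : Set (EuclideanSpace ℝ (Fin n))}
    (hN : IsCompact N) (hM : IsCompact M) (hNM : N ⊆ M) (hU : IsOpen U) (hU' : U.Nonempty)
    (hUM : U ⊆ M \ N) : ∫ x in N, ‖x‖ ^ 2 < ∫ x in M, ‖x‖ ^ 2 := by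
  have : Nonempty (Fin n) := ⟨⟨0, hn⟩⟩
  have hint : IntegrableOn (fun x : EuclideanSpace ℝ (Fin n) => ‖x‖ ^ 2) M :=
    ContinuousOn.integrableOn_compact hM (Continuous.continuousOn (by fun_prop))
  have h1 := setIntegral_sdiff (μ := volume) hN.measurableSet hint hNM
  have h2 : 0 < ∫ x in M \ N, ‖x‖ ^ 2 := by
    rw [setIntegral_pos_iff_support_of_nonneg_ae]
    · refine lt_of_lt_of_le ?_ (measure_mono (s := U \ {0}) ?_)
      · rw [measure_sdiff_null (by simp)]
        exact hU.measure_pos _ hU'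
      · intro x hx
        refine ⟨?_, hUM hx.1⟩
        have : x ≠ 0 := hx.2
        simpa using this
    · exact Filter.Eventually.of_forall fun x => by positivity
    · exact hint.mono_set Set.sdiff_subset
  linarith

theorem moment_pos {n : ℕ} (hn : 1 ≤ n) {M : Set (EuclideanSpace ℝ (Fin n))}
    (hM : IsConvexBodyO M) : 0 < ∫ x in M, ‖x‖ ^ 2 := by
  have := moment_strict hn (N := ∅) isCompact_empty hM.1 (by simp) isOpen_interior ⟨0, hM.2.2⟩
    (by simpa using interior_subset)
  simpa using this

theorem le_supp {n : ℕ} {K : Set (EuclideanSpace ℝ (Fin n))} (hK : IsCompact K)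
    {x : EuclideanSpace ℝ (Fin n)} (hx : x ∈ K) (u : EuclideanSpace ℝ (Fin n)) :
    ⟪x, u⟫ ≤ supp K u := by
  apply le_csSup
  · exact (hK.image (f := fun x => ⟪x, u⟫) (by fun_prop)).bddAbove
  · exact ⟨x, hx, rfl⟩

theorem supp_le {n : ℕ} {K : Set (EuclideanSpace ℝ (Fin n))} (hK : K.Nonempty)
    {u : EuclideanSpace ℝ (Fin n)} {c : ℝ} (h : ∀ x ∈ K, ⟪x, u⟫ ≤ c) :
    supp K u ≤ c := by
  apply csSup_le (hK.image _)
  rintro _ ⟨x, hx, rfl⟩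
  exact h x hx

theorem supp_smul {n : ℕ} (K : Set (EuclideanSpace ℝ (Fin n)))
    (u : EuclideanSpace ℝ (Fin n)) {c : ℝ} (hc : 0 < c) : supp (c • K) u = c * supp K u := by
  unfold supp
  rw [← smul_eq_mul, ← Real.sSup_smul_of_nonneg hc.le]
  congr 1
  ext y
  simp only [Set.mem_image, Set.mem_smul_set]
  constructor
  · rintro ⟨_, ⟨x, hx, rfl⟩, rfl⟩
    exact ⟨_, ⟨x, hx, rfl⟩, by simp [inner_smul_left]⟩
  · rintro ⟨_, ⟨x, hx, rfl⟩, rfl⟩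
    exact ⟨_, ⟨x, hx, rfl⟩, by simp [inner_smul_left]⟩

theorem supp_neg_right {n : ℕ} {K : Set (EuclideanSpace ℝ (Fin n))} (hK : K = -K)
    (u : EuclideanSpace ℝ (Fin n)) : supp K (-u) = supp K u := by
  unfold supp
  congr 1
  ext y
  constructor
  · rintro ⟨x, hx, rfl⟩
    exact ⟨-x, by rw [hK]; simpa using hx, by simp⟩
  · rintro ⟨x, hx, rfl⟩
    exact ⟨-x, by rw [hK]; simpa using hx, by simp⟩

theorem IsConvexBodyO.zero_mem {n : ℕ} {K : Set (EuclideanSpace ℝ (Fin n))}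
    (hK : IsConvexBodyO K) : (0 : EuclideanSpace ℝ (Fin n)) ∈ K := interior_subset hK.2.2

theorem supp_nonneg {n : ℕ} {K : Set (EuclideanSpace ℝ (Fin n))}
    (hK : IsConvexBodyO K) (u : EuclideanSpace ℝ (Fin n)) : 0 ≤ supp K u := by
  simpa using le_supp hK.1 hK.zero_mem u

theorem mem_of_supp {n : ℕ} {K : Set (EuclideanSpace ℝ (Fin n))}
    (hK : IsConvexBodyO K) {x : EuclideanSpace ℝ (Fin n)}
    (hx : ∀ u : EuclideanSpace ℝ (Fin n), ‖u‖ = 1 → ⟪x, u⟫ ≤ supp K u) : x ∈ K := by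
  by_contra hxK
  obtain ⟨f, c, h1, h2⟩ := geometric_hahn_banach_closed_point hK.2.1 hK.1.isClosed hxK
  set v := (InnerProductSpace.toDual ℝ (EuclideanSpace ℝ (Fin n))).symm f with hv
  have hf : ∀ y, f y = ⟪y, v⟫ := by
    intro y
    rw [real_inner_comm, hv, InnerProductSpace.toDual_symm_apply]
  have hv0 : v ≠ 0 := by
    intro h0
    have h3 := h1 0 hK.zero_mem
    rw [hf, h0, inner_zero_right] at h3
    rw [hf, h0, inner_zero_right] at h2
    linarith
  have hpos : 0 < ‖v‖ := norm_pos_iff.2 hv0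
  have h4 := hx (‖v‖⁻¹ • v) (by rw [norm_smul]; simp [hpos.ne'])
  have h5 : supp K (‖v‖⁻¹ • v) ≤ ‖v‖⁻¹ * c := by
    apply supp_le ⟨0, hK.zero_mem⟩
    intro y hy
    rw [inner_smul_right, ← hf]
    have := (h1 y hy).le
    gcongr
  rw [inner_smul_right, ← hf] at h4
  have := lt_of_mul_lt_mul_left ((mul_lt_mul_of_pos_left h2 (inv_pos.2 hpos))) (inv_pos.2 hpos).le
  have h6 := le_of_mul_le_mul_left (h4.trans h5) (inv_pos.2 hpos)
  linarith

theorem subset_of_supp {n : ℕ} {K L : Set (EuclideanSpace ℝ (Fin n))}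
    (hK : IsConvexBodyO K) (hL : IsConvexBodyO L)
    (h : ∀ u : EuclideanSpace ℝ (Fin n), ‖u‖ = 1 → supp K u ≤ supp L u) : K ⊆ L :=
  fun _ hx => mem_of_supp hL fun u hu => (le_supp hK.1 hx u).trans (h u hu)

theorem eq_of_supp {n : ℕ} {K L : Set (EuclideanSpace ℝ (Fin n))}
    (hK : IsConvexBodyO K) (hL : IsConvexBodyO L)
    (h : ∀ u : EuclideanSpace ℝ (Fin n), ‖u‖ = 1 → supp K u = supp L u) : K = L :=
  Set.Subset.antisymm (subset_of_supp hK hL fun u hu => (h u hu).le)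
    (subset_of_supp hL hK fun u hu => (h u hu).ge)

theorem IsConvexBodyO.smul {n : ℕ} {K : Set (EuclideanSpace ℝ (Fin n))}
    (hK : IsConvexBodyO K) {c : ℝ} (hc : 0 < c) : IsConvexBodyO (c • K) := by
  refine ⟨hK.1.smul c, hK.2.1.smul c, ?_⟩
  rw [interior_smul₀ hc.ne']
  exact ⟨0, hK.2.2, by simp⟩

theorem smul_symm {n : ℕ} {K : Set (EuclideanSpace ℝ (Fin n))} (hK : K = -K) (c : ℝ) :
    c • K = -(c • K) := by
  rw [← Set.smul_set_neg, ← hK]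

/-- The normalized form: `K`, `L` have the same moment `T` and `h_M ^ p` is the convex
combination of `h_K ^ p` and `h_L ^ p`. -/
theorem normalized {n : ℕ} (hn : 1 ≤ n) {p : ℝ} (hp : 1 < p) {w v : ℝ} (hw : 0 < w) (hv : 0 < v)
    (hwv : w + v = 1) {K L M : Set (EuclideanSpace ℝ (Fin n))}
    (hK : IsConvexBodyO K) (hL : IsConvexBodyO L) (hM : IsConvexBodyO M)
    (hKs : K = -K) (hLs : L = -L)
    (hMsupp : ∀ u : EuclideanSpace ℝ (Fin n), ‖u‖ = 1 →
      supp M u ^ p = w * supp K u ^ p + v * supp L u ^ p)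
    (hKL : ∫ x in K, ‖x‖ ^ 2 = ∫ x in L, ‖x‖ ^ 2) :
    ∫ x in K, ‖x‖ ^ 2 ≤ ∫ x in M, ‖x‖ ^ 2 ∧
      (∫ x in M, ‖x‖ ^ 2 = ∫ x in K, ‖x‖ ^ 2 → K = L) := by
  have hN : IsCompact (w • K + v • L) := (hK.1.smul w).add (hL.1.smul v)
  have hp0 : 0 < p := by linarith
  have hle : ∀ x ∈ w • K + v • L, ∀ u, ⟪x, u⟫ ≤ w * supp K u + v * supp L u := by
    rintro _ ⟨_, ⟨a, ha, rfl⟩, _, ⟨b, hb, rfl⟩, rfl⟩ u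
    simp only [inner_add_left, inner_smul_left, conj_trivial]
    have h1 := le_supp hK.1 ha u
    have h2 := le_supp hL.1 hb u
    gcongr
  have hconv : ∀ u : EuclideanSpace ℝ (Fin n), ‖u‖ = 1 →
      w * supp K u + v * supp L u ≤ supp M u := by
    intro u hu
    have h0 : 0 ≤ w * supp K u + v * supp L u := by
      have := supp_nonneg hK u
      have := supp_nonneg hL u
      positivity
    rw [← Real.rpow_le_rpow_iff h0 (supp_nonneg hM u) hp0, hMsupp u hu]
    exact (convexOn_rpow hp.le).2 (supp_nonneg hK u) (supp_nonneg hL u) hw.le hv.le hwv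
  have hsub : w • K + v • L ⊆ M := fun x hx =>
    mem_of_supp hM fun u hu => (hle x hx u).trans (hconv u hu)
  have hint : IntegrableOn (fun x : EuclideanSpace ℝ (Fin n) => ‖x‖ ^ 2) M :=
    ContinuousOn.integrableOn_compact hM.1 (Continuous.continuousOn (by fun_prop))
  have h1 := moment_le hw hv hwv hK.1 hL.1 hKs hLs hKL
  have h2 : ∫ x in w • K + v • L, ‖x‖ ^ 2 ≤ ∫ x in M, ‖x‖ ^ 2 :=
    setIntegral_mono_set hint (Filter.Eventually.of_forall fun x => by positivity)
      (LE.le.eventuallyLE hsub)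
  refine ⟨h1.trans h2, fun heq => ?_⟩
  have hMN : M ⊆ w • K + v • L := by
    by_contra hcon
    obtain ⟨x, hxM, hxN⟩ := Set.not_subset.1 hcon
    have hcl : x ∈ closure (interior M) := by
      rw [hM.2.1.closure_interior_eq_closure_of_nonempty_interior ⟨0, hM.2.2⟩]
      exact subset_closure hxM
    obtain ⟨y, hy1, hy2⟩ := mem_closure_iff.1 hcl _ hN.isClosed.isOpen_compl hxN
    have := moment_strict hn hN hM.1 hsub (U := interior M ∩ (w • K + v • L)ᶜ)
      (isOpen_interior.inter hN.isClosed.isOpen_compl) ⟨y, hy2, hy1⟩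
      (fun z hz => ⟨interior_subset hz.1, hz.2⟩)
    linarith
  apply eq_of_supp hK hL
  intro u hu
  by_contra hne
  have h3 := (strictConvexOn_rpow hp).2 (supp_nonneg hK u) (supp_nonneg hL u) hne hw hv hwv
  simp only [smul_eq_mul] at h3
  rw [← hMsupp u hu] at h3
  have h4 : supp M u ≤ w * supp K u + v * supp L u :=
    supp_le ⟨0, hM.zero_mem⟩ fun x hx => hle x (hMN hx) u
  exact absurd (Real.rpow_le_rpow (supp_nonneg hM u) h4 hp0.le) (not_le.2 h3)

/-- Theorem 4.2, `L_p` Brunn–Minkowski inequality for moments of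
inertia. For `1 < p < ∞`, origin-symmetric `K, L ∈ 𝒦ⁿₒ`, and `M = K +_p L` (the convex
body with origin in its interior whose support function satisfies
`h_M^p = h_K^p + h_L^p` on the unit sphere),
`I(M)^{p/(n+2)} ≥ I(K)^{p/(n+2)} + I(L)^{p/(n+2)}`, with equality if and only if `K`
and `L` are dilates. -/
theorem inertia_lp_brunn_minkowski {n : ℕ} (hn : 1 ≤ n) (p : ℝ) (hp : 1 < p)
    (K L M : Set (EuclideanSpace ℝ (Fin n)))
    (hK : IsConvexBodyO K) (hL : IsConvexBodyO L) (hM : IsConvexBodyO M)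
    (hKsymm : K = -K) (hLsymm : L = -L)
    (hMsupp : ∀ u : EuclideanSpace ℝ (Fin n), ‖u‖ = 1 →
      supp M u ^ p = supp K u ^ p + supp L u ^ p) :
    inertia K ^ (p / (n + 2)) + inertia L ^ (p / (n + 2)) ≤
        inertia M ^ (p / (n + 2)) ∧
      (inertia M ^ (p / (n + 2)) =
          inertia K ^ (p / (n + 2)) + inertia L ^ (p / (n + 2)) ↔
        ∃ c : ℝ, 0 < c ∧ K = c • L) := by
  have hp0 : 0 < p := by linarith
  have hMs : M = -M := by
    have hle : ∀ u : EuclideanSpace ℝ (Fin n), ‖u‖ = 1 → supp M (-u) = supp M u := by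
      intro u hu
      have h1 := hMsupp (-u) (by simpa using hu)
      rw [supp_neg_right hKsymm, supp_neg_right hLsymm, ← hMsupp u hu] at h1
      exact (Real.rpow_left_inj (supp_nonneg hM _) (supp_nonneg hM _) hp0.ne').1 h1
    have hneg : ∀ x ∈ M, -x ∈ M := by
      intro x hx
      refine mem_of_supp hM fun u hu => ?_
      rw [← hle u hu, inner_neg_left, ← inner_neg_right]
      exact le_supp hM.1 hx _
    ext x
    exact ⟨fun h => hneg x h, fun h => by simpa using hneg _ h⟩
  rw [inertia_symm hKsymm, inertia_symm hLsymm, inertia_symm hMs]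
  have hA := moment_pos hn hK
  have hB := moment_pos hn hL
  have hC := moment_pos hn hM
  set A := ∫ x in K, ‖x‖ ^ 2 with hAdef
  set B := ∫ x in L, ‖x‖ ^ 2 with hBdef
  set C := ∫ x in M, ‖x‖ ^ 2 with hCdef
  have hm : (0:ℝ) < (n:ℝ) + 2 := by positivity
  have root : ∀ X : ℝ, 0 < X → ∃ a : ℝ, 0 < a ∧ X = a ^ (n + 2) ∧ X ^ (p / ((n:ℝ) + 2)) = a ^ p := by
    intro X hX
    refine ⟨X ^ (1 / ((n:ℝ) + 2)), by positivity, ?_, ?_⟩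
    · rw [← Real.rpow_natCast, ← Real.rpow_mul hX.le]
      push_cast
      rw [one_div_mul_cancel hm.ne', Real.rpow_one]
    · rw [← Real.rpow_mul hX.le]
      congr 1
      ring
  obtain ⟨a, ha, hAa, hAp⟩ := root A hA
  obtain ⟨b, hb, hBb, hBp⟩ := root B hB
  obtain ⟨c, hc, hCc, hCp⟩ := root C hC
  rw [hAp, hBp, hCp]
  have hap : 0 < a ^ p := by positivity
  have hbp : 0 < b ^ p := by positivity
  obtain ⟨s, hs, hsp⟩ : ∃ s : ℝ, 0 < s ∧ s ^ p = a ^ p + b ^ p := by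
    refine ⟨(a ^ p + b ^ p) ^ (1 / p), by positivity, ?_⟩
    rw [← Real.rpow_mul (by positivity), one_div_mul_cancel hp0.ne', Real.rpow_one]
  have hspp : 0 < s ^ p := by positivity
  have hmK : ∫ x in (s / a) • K, ‖x‖ ^ 2 = s ^ (n + 2) := by
    rw [moment_smul K (by positivity), ← hAdef, hAa, ← mul_pow, div_mul_cancel₀ _ ha.ne']
  have hmL : ∫ x in (s / b) • L, ‖x‖ ^ 2 = s ^ (n + 2) := by
    rw [moment_smul L (by positivity), ← hBdef, hBb, ← mul_pow, div_mul_cancel₀ _ hb.ne']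
  obtain ⟨key1, key2⟩ := normalized hn hp (w := a ^ p / s ^ p) (v := b ^ p / s ^ p)
    (by positivity) (by positivity) (by rw [← add_div, ← hsp, div_self hspp.ne'])
    (hK.smul (c := s / a) (by positivity)) (hL.smul (c := s / b) (by positivity)) hM
    (smul_symm hKsymm _) (smul_symm hLsymm _)
    (by
      intro u hu
      rw [hMsupp u hu, supp_smul _ _ (by positivity), supp_smul _ _ (by positivity),
        Real.mul_rpow (by positivity) (supp_nonneg hK u),
        Real.mul_rpow (by positivity) (supp_nonneg hL u),
        Real.div_rpow hs.le ha.le, Real.div_rpow hs.le hb.le]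
      field_simp)
    (by rw [hmK, hmL])
  rw [hmK, ← hCdef, hCc] at key1 key2
  have hsc : s ≤ c := le_of_pow_le_pow_left₀ (by omega) hc.le key1
  refine ⟨?_, ?_, ?_⟩
  · rw [← hsp]
    exact Real.rpow_le_rpow hs.le hsc hp0.le
  · intro heq
    rw [← hsp] at heq
    have hcs : c = s := (Real.rpow_left_inj hc.le hs.le hp0.ne').1 heq
    have h1 := key2 (by rw [hcs])
    refine ⟨a / b, by positivity, ?_⟩
    have h2 : (a / s) • ((s / a) • K) = (a / s) • ((s / b) • L) := by rw [h1]
    rw [smul_smul, smul_smul] at h2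
    have e1 : a / s * (s / a) = 1 := by field_simp
    have e2 : a / s * (s / b) = a / b := by field_simp
    rwa [e1, e2, one_smul] at h2
  · rintro ⟨d, hd, hKL⟩
    have had : a = d * b := by
      have h1 : A = d ^ (n + 2) * B := by
        rw [hAdef, hKL, moment_smul L hd]
      rw [hAa, hBb, ← mul_pow] at h1
      exact (pow_left_inj₀ ha.le (by positivity) (by omega)).1 h1
    have hML : M = (s / b) • L := by
      apply eq_of_supp hM (hL.smul (by positivity))
      intro u hu
      rw [supp_smul _ _ (by positivity)]
      have hLu := supp_nonneg hL u
      refine (Real.rpow_left_inj (supp_nonneg hM u) (by positivity) hp0.ne').1 ?_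
      rw [hMsupp u hu, hKL, supp_smul _ _ hd, Real.mul_rpow hd.le hLu,
        Real.mul_rpow (by positivity) hLu, Real.div_rpow hs.le hb.le, hsp, had,
        Real.mul_rpow hd.le hb.le]
      field_simp
    have hcs : c = s := by
      have h1 : C = s ^ (n + 2) := by rw [hCdef, hML, hmL]
      rw [hCc] at h1
      exact (pow_left_inj₀ hc.le hs.le (by omega)).1 h1
    rw [hcs, hsp]
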